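/- Suppose the support of P_X is contained in B_M for some constant M > 0 and λ₁,…,λ_d ≥ 0. For any δ ∈ (0, 1/2), with probability at least 1 − 2δ over the i.i.d. sample X^(1),…,X^(n) ~ P_X, the following holds simultaneously for every Borel probability measure ν on ℝ^d with finite first moment: D(P_X, ν) ≤ D(P̂ⁿ, ν) + 2 R̂_n(F_λ) + 3M(1 + ‖λ‖₂) √(2 log(1/δ)/n), where ‖λ‖₂ = (Σ_{j=1}^d λ_j²)^{1/2}. (In the paper, ν ranges over a family {P_θ : θ ∈ Θ} of generative distributions; the bound holds uniformly over all such ν.) -/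

import Mathlib

open MeasureTheory Set
open scoped ENNReal

/-- The 1-Wasserstein distance between two measures, defined via the primal
(optimal transport) formulation: the infimum of `∫ ‖x - y‖ dπ` over all
couplings `π` of `μ` and `ν`. -/
noncomputable def W1 {E : Type*} [MeasurableSpace E] [NormedAddCommGroup E]
    (μ ν : Measure E) : ℝ :=
  sInf {c : ℝ | ∃ π : Measure (E × E), IsProbabilityMeasure π ∧
    π.map Prod.fst = μ ∧ π.map Prod.snd = ν ∧ c = ∫ p, ‖p.1 - p.2‖ ∂π}

/-- A measure has a finite first moment. -/
def FiniteFirstMoment {E : Type*} [MeasurableSpace E] [NormedAddCommGroup E]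
    (μ : Measure E) : Prop :=
  HasFiniteIntegral (fun x => ‖x‖) μ

/-- The marginally-penalized Wasserstein (MPW) distance with weights `lam`. -/
noncomputable def MPW {d : ℕ} (lam : Fin d → ℝ)
    (μ ν : Measure (EuclideanSpace ℝ (Fin d))) : ℝ :=
  W1 μ ν + ∑ j : Fin d, lam j * W1 (μ.map (fun x => x j)) (ν.map (fun x => x j))

/-- The empirical measure of a sample `x : Fin n → E`. -/
noncomputable def empMeasure {E : Type*} [MeasurableSpace E] {n : ℕ}
    (x : Fin n → E) : Measure E :=
  (n : ℝ≥0∞)⁻¹ • ∑ i : Fin n, Measure.dirac (x i)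

/-- The function class `F_λ`: functions of the form `f + ∑ j, λ j * (f_j ∘ p_j)`
with `f` 1-Lipschitz on `ℝ^d` and each `f_j` 1-Lipschitz on `ℝ`. -/
def Flam {d : ℕ} (lam : Fin d → ℝ) : Set (EuclideanSpace ℝ (Fin d) → ℝ) :=
  {φ | ∃ (f : EuclideanSpace ℝ (Fin d) → ℝ) (g : Fin d → ℝ → ℝ),
    LipschitzWith 1 f ∧ (∀ j, LipschitzWith 1 (g j)) ∧
    ∀ x, φ x = f x + ∑ j : Fin d, lam j * g j (x j)}

/-- The empirical Rademacher complexity `R̂_n(F_λ)` of the centered class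
`{φ - φ(0) : φ ∈ F_λ}` at the sample `x`: the expectation over i.i.d. Rademacher
signs `ε` of `sup_{φ ∈ F_λ} ∑ i, ε_i (φ(x_i) - φ(0))`, divided by `n`. -/
noncomputable def rademacherComplexity {d n : ℕ} (lam : Fin d → ℝ)
    (x : Fin n → EuclideanSpace ℝ (Fin d)) : ℝ :=
  (n : ℝ)⁻¹ * ((2 ^ n : ℝ)⁻¹ * ∑ s : Fin n → Bool,
    sSup {r : ℝ | ∃ φ ∈ Flam lam,
      r = ∑ i : Fin n, (if s i then (1 : ℝ) else -1) * (φ (x i) - φ 0)})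

open ProbabilityTheory

/-- A sublinear functional is touched at any given point by a dominated linear functional. -/
lemma exists_linear_le_sublinear {E : Type*} [AddCommGroup E] [Module ℝ E] (N : E → ℝ)
    (N_hom : ∀ c : ℝ, 0 < c → ∀ x, N (c • x) = c * N x)
    (N_add : ∀ x y, N (x + y) ≤ N x + N y) (x₀ : E) :
    ∃ g : E →ₗ[ℝ] ℝ, g x₀ = N x₀ ∧ ∀ x, g x ≤ N x := by
  have N_0 : N 0 = 0 := by
    have := N_hom 2 (by norm_num) 0
    rw [smul_zero] at this
    linarith
  have key : ∀ c : ℝ, c * N x₀ ≤ N (c • x₀) := by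
    intro c
    rcases lt_trichotomy c 0 with hc | hc | hc
    · have h1 := N_add (c • x₀) ((-c) • x₀)
      rw [N_hom (-c) (by linarith), ← add_smul, add_neg_cancel, zero_smul, N_0] at h1
      linarith
    · simp [hc, N_0]
    · rw [N_hom c hc]
  have H : ∀ c : ℝ, c • x₀ = 0 → (RingHom.id ℝ) c • N x₀ = 0 := by
    intro c hc
    by_cases h : c = 0
    · simp [h]
    · have : x₀ = 0 := (smul_eq_zero.1 hc).resolve_left h
      simp [this, N_0]
  obtain ⟨g, hg, hgN⟩ := exists_extension_of_le_sublinear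
    (LinearPMap.mkSpanSingleton' x₀ (N x₀) H) N N_hom N_add (by
      rintro ⟨x, hx⟩
      obtain ⟨c, rfl⟩ := Submodule.mem_span_singleton.1 hx
      rw [LinearPMap.mkSpanSingleton'_apply]
      exact key c)
  refine ⟨g, ?_, hgN⟩
  have h := hg ⟨x₀, Submodule.mem_span_singleton_self x₀⟩
  exact h.trans (LinearPMap.mkSpanSingleton'_apply_self _ _ _ _)

/-- A positive linear functional on the continuous functions of a compact space is the integral
against a finite measure. -/
lemma exists_measure_of_positive_linear {X : Type*} [TopologicalSpace X] [T2Space X]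
    [CompactSpace X] [MeasurableSpace X] [BorelSpace X] (L : C(X, ℝ) →ₗ[ℝ] ℝ)
    (hL : ∀ h : C(X, ℝ), (∀ x, 0 ≤ h x) → 0 ≤ L h) :
    ∃ π : Measure X, IsFiniteMeasure π ∧ ∀ h : C(X, ℝ), ∫ x, h x ∂π = L h := by
  let T : CompactlySupportedContinuousMap X ℝ →ₗ[ℝ] ℝ :=
    { toFun := fun f => L f.toContinuousMap
      map_add' := fun f g => map_add L f.toContinuousMap g.toContinuousMap
      map_smul' := fun c f => map_smul L c f.toContinuousMap }
  let Λ := PositiveLinearMap.mk₀ T (fun f hf => hL _ hf)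
  refine ⟨RealRMK.rieszMeasure Λ, inferInstance, fun h => ?_⟩
  exact RealRMK.integral_rieszMeasure Λ ⟨h, HasCompactSupport.of_compactSpace _⟩

lemma ContinuousMap.integrable_of_compactSpace {X : Type*} [TopologicalSpace X]
    [CompactSpace X] [MeasurableSpace X] [BorelSpace X] (μ : Measure X) [IsFiniteMeasure μ]
    (f : C(X, ℝ)) : Integrable f μ :=
  (BoundedContinuousFunction.mkOfCompact f).integrable μ

section Duality

variable {K : Type*} [TopologicalSpace K] [MeasurableSpace K]

/-- The values of the dual problem of superhedging `h` by sums `φ ⊕ ψ`. -/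
def superhedgingCosts (P Q : Measure K) (h : C(K × K, ℝ)) : Set ℝ :=
  {r | ∃ φ ψ : C(K, ℝ), (∀ x y, h (x, y) ≤ φ x + ψ y) ∧ r = ∫ x, φ x ∂P + ∫ y, ψ y ∂Q}

variable (P Q : Measure K)

lemma mem_superhedgingCosts {h : C(K × K, ℝ)} (φ ψ : C(K, ℝ))
    (H : ∀ x y, h (x, y) ≤ φ x + ψ y) :
    ∫ x, φ x ∂P + ∫ y, ψ y ∂Q ∈ superhedgingCosts P Q h :=
  ⟨φ, ψ, H, rfl⟩

lemma smul_mem_superhedgingCosts {h : C(K × K, ℝ)} {r c : ℝ} (hc : 0 ≤ c)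
    (hr : r ∈ superhedgingCosts P Q h) : c * r ∈ superhedgingCosts P Q (c • h) := by
  obtain ⟨φ, ψ, H, rfl⟩ := hr
  convert mem_superhedgingCosts P Q (h := c • h) (c • φ) (c • ψ) (fun x y => ?_) using 1
  · simp [integral_const_mul, mul_add]
  · have := mul_le_mul_of_nonneg_left (H x y) hc
    simpa [mul_add] using this

variable [CompactSpace K]

lemma superhedgingCosts_nonempty (h : C(K × K, ℝ)) : (superhedgingCosts P Q h).Nonempty :=
  ⟨_, mem_superhedgingCosts P Q (ContinuousMap.const K ‖h‖) 0 fun x y => by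
    simpa using (abs_le.1 (h.norm_coe_le_norm (x, y))).2⟩

variable [BorelSpace K] [IsProbabilityMeasure P] [IsProbabilityMeasure Q]

lemma le_integral_add_integral {c : ℝ} (φ ψ : C(K, ℝ)) (H : ∀ x y, c ≤ φ x + ψ y) :
    c ≤ ∫ x, φ x ∂P + ∫ y, ψ y ∂Q := by
  have h1 : ∀ x, c - φ x ≤ ∫ y, ψ y ∂Q := fun x => by
    have := integral_mono (μ := Q) (integrable_const (c - φ x))
      (ψ.integrable_of_compactSpace Q) (fun y => by have := H x y; show c - φ x ≤ ψ y; linarith)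
    simpa using this
  have := integral_mono (μ := P) (integrable_const (c - ∫ y, ψ y ∂Q))
      (φ.integrable_of_compactSpace P)
      (fun x => by have := h1 x; show c - _ ≤ φ x; linarith)
  simp at this
  linarith

lemma superhedgingCosts_bddBelow (h : C(K × K, ℝ)) : BddBelow (superhedgingCosts P Q h) := by
  refine ⟨-‖h‖, ?_⟩
  rintro r ⟨φ, ψ, H, rfl⟩
  refine le_integral_add_integral P Q φ ψ fun x y => le_trans ?_ (H x y)
  exact (abs_le.1 (h.norm_coe_le_norm (x, y))).1

lemma sInf_superhedgingCosts_smul (c : ℝ) (hc : 0 < c) (h : C(K × K, ℝ)) :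
    sInf (superhedgingCosts P Q (c • h)) = c * sInf (superhedgingCosts P Q h) := by
  have key : ∀ (c : ℝ), 0 < c → ∀ h : C(K × K, ℝ),
      sInf (superhedgingCosts P Q (c • h)) ≤ c * sInf (superhedgingCosts P Q h) := by
    intro c hc h
    rw [← div_le_iff₀' hc]
    refine le_csInf (superhedgingCosts_nonempty P Q h) fun r hr => ?_
    rw [div_le_iff₀' hc]
    exact csInf_le (superhedgingCosts_bddBelow P Q _) (smul_mem_superhedgingCosts P Q hc.le hr)
  refine le_antisymm (key c hc h) ?_
  have := key c⁻¹ (inv_pos.2 hc) (c • h)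
  rw [smul_smul, inv_mul_cancel₀ hc.ne', one_smul] at this
  rwa [← div_eq_inv_mul, le_div_iff₀' hc] at this

lemma sInf_superhedgingCosts_add (h k : C(K × K, ℝ)) :
    sInf (superhedgingCosts P Q (h + k)) ≤
      sInf (superhedgingCosts P Q h) + sInf (superhedgingCosts P Q k) := by
  rw [← sub_le_iff_le_add]
  refine le_csInf (superhedgingCosts_nonempty P Q h) ?_
  rintro r ⟨φ, ψ, H, rfl⟩
  rw [sub_le_iff_le_add', ← sub_le_iff_le_add]
  refine le_csInf (superhedgingCosts_nonempty P Q k) ?_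
  rintro r ⟨φ', ψ', H', rfl⟩
  rw [sub_le_iff_le_add']
  refine (csInf_le (superhedgingCosts_bddBelow P Q _)
    (mem_superhedgingCosts P Q (φ + φ') (ψ + ψ') fun x y => ?_)).trans_eq ?_
  · have h1 := H x y
    have h2 := H' x y
    simp only [ContinuousMap.add_apply]
    linarith
  · have e1 := integral_add (φ.integrable_of_compactSpace P) (φ'.integrable_of_compactSpace P)
    have e2 := integral_add (ψ.integrable_of_compactSpace Q) (ψ'.integrable_of_compactSpace Q)
    simp only [ContinuousMap.add_apply]
    rw [e1, e2]
    ring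

/-- Kantorovich duality on a compact space: some coupling attains the dual value. -/
theorem exists_coupling_integral_eq [T2Space K] [SecondCountableTopology K]
    [HasOuterApproxClosed K] (c : C(K × K, ℝ)) :
    ∃ π : Measure (K × K), IsProbabilityMeasure π ∧ π.map Prod.fst = P ∧ π.map Prod.snd = Q ∧
      ∫ p, c p ∂π = -sInf (superhedgingCosts P Q (-c)) := by
  obtain ⟨L, hLc, hL⟩ := exists_linear_le_sublinear
    (fun h => sInf (superhedgingCosts P Q h)) (sInf_superhedgingCosts_smul P Q)
    (sInf_superhedgingCosts_add P Q) (-c)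
  have hle : ∀ (h : C(K × K, ℝ)) (φ ψ : C(K, ℝ)), (∀ x y, h (x, y) ≤ φ x + ψ y) →
      L h ≤ ∫ x, φ x ∂P + ∫ y, ψ y ∂Q := fun h φ ψ H =>
    (hL h).trans (csInf_le (superhedgingCosts_bddBelow P Q h) (mem_superhedgingCosts P Q φ ψ H))
  obtain ⟨π, hπ, hπL⟩ := exists_measure_of_positive_linear L (fun h hh => by
    have := hle (-h) 0 0 (fun x y => by simpa using hh (x, y))
    simpa using this)
  have hfst : ∀ φ : C(K, ℝ), L (φ.comp ⟨Prod.fst, continuous_fst⟩) = ∫ x, φ x ∂P := by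
    intro φ
    apply le_antisymm
    · simpa using hle (φ.comp ⟨Prod.fst, continuous_fst⟩) φ 0 (fun x y => by simp)
    · have := hle (-(φ.comp ⟨Prod.fst, continuous_fst⟩)) (-φ) 0 (fun x y => by simp)
      simpa [integral_neg] using this
  have hsnd : ∀ φ : C(K, ℝ), L (φ.comp ⟨Prod.snd, continuous_snd⟩) = ∫ x, φ x ∂Q := by
    intro φ
    apply le_antisymm
    · simpa using hle (φ.comp ⟨Prod.snd, continuous_snd⟩) 0 φ (fun x y => by simp)
    · have := hle (-(φ.comp ⟨Prod.snd, continuous_snd⟩)) 0 (-φ) (fun x y => by simp)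
      simpa [integral_neg] using this
  have m1 : π.map Prod.fst = P := by
    refine ext_of_forall_integral_eq_of_IsFiniteMeasure fun f => ?_
    rw [integral_map measurable_fst.aemeasurable f.continuous.aestronglyMeasurable]
    exact (hπL _).trans (hfst f.toContinuousMap)
  have m2 : π.map Prod.snd = Q := by
    refine ext_of_forall_integral_eq_of_IsFiniteMeasure fun f => ?_
    rw [integral_map measurable_snd.aemeasurable f.continuous.aestronglyMeasurable]
    exact (hπL _).trans (hsnd f.toContinuousMap)
  refine ⟨π, ⟨?_⟩, m1, m2, ?_⟩
  · have : π.map Prod.fst univ = 1 := by rw [m1]; simp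
    rwa [Measure.map_apply measurable_fst MeasurableSet.univ, preimage_univ] at this
  · rw [hπL, ← hLc, map_neg, neg_neg]

end Duality

/-- The infimal convolution of the distance with a function bounded below is `1`-Lipschitz. -/
lemma lipschitzWith_iInf_dist_add {E ι : Type*} [PseudoMetricSpace E] [Nonempty ι]
    (p : ι → E) (u : ι → ℝ) (hu : BddBelow (range u)) :
    LipschitzWith 1 (fun x => ⨅ i, (dist x (p i) + u i)) := by
  obtain ⟨b, hb⟩ := hu
  have hbdd : ∀ x, BddBelow (range fun i => dist x (p i) + u i) := fun x =>
    ⟨b, by rintro _ ⟨i, rfl⟩; exact (hb ⟨i, rfl⟩).trans (le_add_of_nonneg_left dist_nonneg)⟩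
  refine LipschitzWith.of_le_add fun x y => ?_
  rw [← sub_le_iff_le_add]
  refine le_ciInf fun i => ?_
  rw [sub_le_iff_le_add]
  refine (ciInf_le (hbdd x) i).trans ?_
  have := dist_triangle x y (p i)
  linarith

section Wasserstein

variable {E : Type*} [MeasurableSpace E] [NormedAddCommGroup E]

lemma W1_bddBelow (μ ν : Measure E) :
    BddBelow {c : ℝ | ∃ π : Measure (E × E), IsProbabilityMeasure π ∧
      π.map Prod.fst = μ ∧ π.map Prod.snd = ν ∧ c = ∫ p, ‖p.1 - p.2‖ ∂π} :=
  ⟨0, by rintro _ ⟨π, -, -, -, rfl⟩; exact integral_nonneg fun _ => norm_nonneg _⟩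

lemma W1_le {μ ν : Measure E} (π : Measure (E × E)) [IsProbabilityMeasure π]
    (h1 : π.map Prod.fst = μ) (h2 : π.map Prod.snd = ν) :
    W1 μ ν ≤ ∫ p, ‖p.1 - p.2‖ ∂π :=
  csInf_le (W1_bddBelow μ ν) ⟨π, inferInstance, h1, h2, rfl⟩

lemma exists_coupling_lt {μ ν : Measure E} [IsProbabilityMeasure μ] [IsProbabilityMeasure ν]
    {ε : ℝ} (hε : 0 < ε) :
    ∃ π : Measure (E × E), IsProbabilityMeasure π ∧ π.map Prod.fst = μ ∧ π.map Prod.snd = ν ∧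
      ∫ p, ‖p.1 - p.2‖ ∂π < W1 μ ν + ε := by
  obtain ⟨c, ⟨π, hπ, h1, h2, rfl⟩, hc⟩ := exists_lt_of_csInf_lt
    (s := {c : ℝ | ∃ π : Measure (E × E), IsProbabilityMeasure π ∧
      π.map Prod.fst = μ ∧ π.map Prod.snd = ν ∧ c = ∫ p, ‖p.1 - p.2‖ ∂π})
    ⟨_, μ.prod ν, inferInstance, by simp, by simp, rfl⟩
    (show W1 μ ν < W1 μ ν + ε by linarith)
  exact ⟨π, hπ, h1, h2, hc⟩

variable [BorelSpace E] [SecondCountableTopology E]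

/-- Kantorovich–Rubinstein duality for measures concentrated on a common compact set. -/
theorem exists_lipschitz_W1_le {K : Set E} (hK : IsCompact K) (P Q : Measure E)
    [IsProbabilityMeasure P] [IsProbabilityMeasure Q] (hP : P Kᶜ = 0) (hQ : Q Kᶜ = 0)
    {ε : ℝ} (hε : 0 < ε) :
    ∃ f : E → ℝ, LipschitzWith 1 f ∧ W1 P Q ≤ ∫ x, f x ∂P - ∫ x, f x ∂Q + ε := by
  have : CompactSpace K := isCompact_iff_compactSpace.1 hK
  have hKm : MeasurableSet K := hK.measurableSet
  have hemb : MeasurableEmbedding (Subtype.val : K → E) := MeasurableEmbedding.subtype_coe hKm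
  have hmap : ∀ (R : Measure E), R Kᶜ = 0 → (R.comap Subtype.val : Measure K).map Subtype.val = R :=
    fun R hR => by
      rw [(MeasurableEmbedding.subtype_coe hKm).map_comap, Subtype.range_coe]
      exact Measure.restrict_eq_self_of_ae_mem (mem_ae_iff.2 hR)
  have hprob : ∀ (R : Measure E) [IsProbabilityMeasure R], R Kᶜ = 0 →
      IsProbabilityMeasure (R.comap Subtype.val : Measure K) := fun R _ hR => ⟨by
    have := congrArg (fun S : Measure E => S univ) (hmap R hR)
    simpa [Measure.map_apply measurable_subtype_coe MeasurableSet.univ] using this⟩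
  have := hprob P hP
  have := hprob Q hQ
  set P' : Measure K := P.comap Subtype.val with hP'
  set Q' : Measure K := Q.comap Subtype.val with hQ'
  have hne : Nonempty K := P'.nonempty_of_neZero
  obtain ⟨π, hπ, h1, h2, hc⟩ := exists_coupling_integral_eq P' Q'
    (⟨fun p => ‖(p.1 : E) - p.2‖, by fun_prop⟩ : C(K × K, ℝ))
  obtain ⟨r, ⟨φ, ψ, H, rfl⟩, hr⟩ := exists_lt_of_csInf_lt (superhedgingCosts_nonempty P' Q' _)
    (lt_add_of_pos_right (sInf (superhedgingCosts P' Q'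
      (-(⟨fun p => ‖(p.1 : E) - p.2‖, by fun_prop⟩ : C(K × K, ℝ))))) hε)
  have hψ : BddBelow (range ψ) := (isCompact_range ψ.continuous).bddBelow
  have hbdd : ∀ x : E, BddBelow (range fun y : K => dist x (y : E) + ψ y) := by
    obtain ⟨b, hb⟩ := hψ
    exact fun x => ⟨b, by
      rintro _ ⟨i, rfl⟩; exact (hb ⟨i, rfl⟩).trans (le_add_of_nonneg_left dist_nonneg)⟩
  have hf := lipschitzWith_iInf_dist_add (Subtype.val : K → E) ψ hψ
  set f : E → ℝ := fun x => ⨅ y : K, (dist x (y : E) + ψ y) with hfdef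
  let fK : C(K, ℝ) := ⟨fun x => f x, hf.continuous.comp continuous_subtype_val⟩
  have hfP : ∫ x, f x ∂P = ∫ x, fK x ∂P' := by
    conv_lhs => rw [← hmap P hP]
    exact hemb.integral_map _
  have hfQ : ∫ x, f x ∂Q = ∫ x, fK x ∂Q' := by
    conv_lhs => rw [← hmap Q hQ]
    exact hemb.integral_map _
  have hφf : -∫ x, φ x ∂P' ≤ ∫ x, fK x ∂P' := by
    rw [← integral_neg]
    refine integral_mono (φ.integrable_of_compactSpace P').neg (fK.integrable_of_compactSpace P')
      fun x => le_ciInf fun y => ?_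
    have := H x y
    simp only [ContinuousMap.neg_apply, ContinuousMap.coe_mk] at this
    rw [dist_eq_norm]
    linarith
  have hfψ : ∫ x, fK x ∂Q' ≤ ∫ x, ψ x ∂Q' :=
    integral_mono (fK.integrable_of_compactSpace Q') (ψ.integrable_of_compactSpace Q')
      fun x => (ciInf_le (hbdd x) x).trans_eq (by simp)
  refine ⟨f, hf, ?_⟩
  have hm : Measurable (Prod.map Subtype.val Subtype.val : K × K → E × E) := by fun_prop
  have hπ' : IsProbabilityMeasure (π.map (Prod.map Subtype.val Subtype.val : K × K → E × E)) :=
    Measure.isProbabilityMeasure_map hm.aemeasurable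
  have hW := W1_le (μ := P) (ν := Q) (π.map (Prod.map Subtype.val Subtype.val))
    (by rw [Measure.map_map measurable_fst hm, ← hmap P hP, ← hP', ← h1,
          Measure.map_map measurable_subtype_coe measurable_fst]; rfl)
    (by rw [Measure.map_map measurable_snd hm, ← hmap Q hQ, ← hQ', ← h2,
          Measure.map_map measurable_subtype_coe measurable_snd]; rfl)
  rw [integral_map hm.aemeasurable
    (by fun_prop : Continuous fun p : E × E => ‖p.1 - p.2‖).aestronglyMeasurable] at hW
  have hc' : ∫ p, ‖(p.1 : E) - p.2‖ ∂π = _ := hc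
  simp only [Prod.map_fst, Prod.map_snd] at hW
  rw [hc'] at hW
  rw [hfP, hfQ]
  linarith

/-- The triangle inequality for the Wasserstein distance. -/
theorem W1_triangle [StandardBorelSpace E] {μ ν ρ : Measure E} [IsProbabilityMeasure μ]
    [IsProbabilityMeasure ν] [IsProbabilityMeasure ρ] (hμ : Integrable (fun x => ‖x‖) μ)
    (hν : Integrable (fun x => ‖x‖) ν) (hρ : Integrable (fun x => ‖x‖) ρ) :
    W1 μ ρ ≤ W1 μ ν + W1 ν ρ := by
  refine le_of_forall_pos_le_add fun ε hε => ?_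
  obtain ⟨π, hπ, hπ1, hπ2, hπc⟩ := exists_coupling_lt (μ := μ) (ν := ν) (half_pos hε)
  obtain ⟨σ, hσ, hσ1, hσ2, hσc⟩ := exists_coupling_lt (μ := ν) (ν := ρ) (half_pos hε)
  have hint : ∀ (R S : Measure E) (τ : Measure (E × E)), Integrable (fun x => ‖x‖) R →
      Integrable (fun x => ‖x‖) S → τ.map Prod.fst = R → τ.map Prod.snd = S →
      Integrable (fun p : E × E => ‖p.1 - p.2‖) τ := by
    rintro R S τ hR hS rfl rfl
    have h1 := hR.comp_measurable measurable_fst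
    have h2 := hS.comp_measurable measurable_snd
    refine (h1.add h2).mono' (by fun_prop : Continuous _).aestronglyMeasurable
      (ae_of_all _ fun p => ?_)
    simpa using norm_sub_le p.1 p.2
  let κ : Kernel (E × E) E := σ.condKernel.comap Prod.snd measurable_snd
  let γ : Measure ((E × E) × E) := π ⊗ₘ κ
  have hγ1 : γ.map Prod.fst = π := Measure.fst_compProd π κ
  have hγ2 : γ.map (fun p => (p.1.2, p.2)) = σ := by
    refine Measure.ext_of_lintegral _ fun f hf => ?_
    rw [lintegral_map hf (by fun_prop), Measure.lintegral_compProd (by fun_prop)]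
    conv_rhs => rw [← σ.disintegrate σ.condKernel, Measure.lintegral_compProd hf]
    have e : σ.fst = π.map Prod.snd := by rw [hπ2]; exact hσ1
    rw [e, lintegral_map (by fun_prop) measurable_snd]
    rfl
  have i1 := hint μ ν π hμ hν hπ1 hπ2
  have i2 := hint ν ρ σ hν hρ hσ1 hσ2
  have mout : Measurable fun p : (E × E) × E => (p.1.1, p.2) := by fun_prop
  have : IsProbabilityMeasure (γ.map fun p => (p.1.1, p.2)) :=
    Measure.isProbabilityMeasure_map mout.aemeasurable
  have hW := W1_le (μ := μ) (ν := ρ) (γ.map fun p => (p.1.1, p.2))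
    (by rw [Measure.map_map measurable_fst mout, ← hπ1, ← hγ1,
          Measure.map_map measurable_fst measurable_fst]; rfl)
    (by rw [Measure.map_map measurable_snd mout, ← hσ2, ← hγ2,
          Measure.map_map measurable_snd (by fun_prop)]; rfl)
  have hcont : Continuous fun p : E × E => ‖p.1 - p.2‖ := by fun_prop
  rw [integral_map mout.aemeasurable hcont.aestronglyMeasurable] at hW
  have j1 : Integrable (fun p : (E × E) × E => ‖p.1.1 - p.1.2‖) γ := by
    rw [← hγ1] at i1; exact i1.comp_measurable measurable_fst
  have j2 : Integrable (fun p : (E × E) × E => ‖p.1.2 - p.2‖) γ := by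
    rw [← hγ2] at i2; exact i2.comp_measurable (by fun_prop)
  have e1 : ∫ p, ‖p.1.1 - p.1.2‖ ∂γ = ∫ p, ‖p.1 - p.2‖ ∂π := by
    conv_rhs => rw [← hγ1, integral_map measurable_fst.aemeasurable hcont.aestronglyMeasurable]
  have e2 : ∫ p, ‖p.1.2 - p.2‖ ∂γ = ∫ p, ‖p.1 - p.2‖ ∂σ := by
    conv_rhs => rw [← hγ2, integral_map (by fun_prop) hcont.aestronglyMeasurable]
  have hle : ∫ p, ‖p.1.1 - p.2‖ ∂γ ≤ ∫ p, (‖p.1.1 - p.1.2‖ + ‖p.1.2 - p.2‖) ∂γ := by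
    refine integral_mono_of_nonneg (ae_of_all _ fun _ => norm_nonneg _) (j1.add j2)
      (ae_of_all _ fun p => ?_)
    exact norm_sub_le_norm_sub_add_norm_sub _ _ _
  rw [integral_add j1 j2, e1, e2] at hle
  linarith

end Wasserstein

section BoundedDifferences

variable {Ω : Type*} [MeasurableSpace Ω]

lemma integrable_of_forall_abs_le {μ : Measure Ω} [IsFiniteMeasure μ] {f : Ω → ℝ}
    (hf : Measurable f) {C : ℝ} (hC : ∀ x, |f x| ≤ C) : Integrable f μ :=
  Integrable.of_bound hf.aestronglyMeasurable C (ae_of_all _ hC)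

lemma measurable_finCons {n : ℕ} :
    Measurable (fun p : Ω × (Fin n → Ω) => (Fin.cons p.1 p.2 : Fin (n + 1) → Ω)) := by
  refine measurable_pi_iff.2 fun i => ?_
  refine Fin.cases ?_ (fun j => ?_) i
  · simpa using measurable_fst
  · simpa using! (measurable_pi_apply j).comp measurable_snd

lemma measurePreserving_finCons (μ : Measure Ω) [IsProbabilityMeasure μ] (n : ℕ) :
    MeasurePreserving (fun p : Ω × (Fin n → Ω) => (Fin.cons p.1 p.2 : Fin (n + 1) → Ω))
      (μ.prod (Measure.pi fun _ => μ)) (Measure.pi fun _ => μ) := by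
  have h := (measurePreserving_piFinSuccAbove (fun _ : Fin (n + 1) => μ) 0).symm
  convert h using 1
  ext p : 1
  simp only [MeasurableEquiv.piFinSuccAbove]
  exact (Fin.insertNth_zero' p.1 p.2).symm

lemma integral_pi_succ (μ : Measure Ω) [IsProbabilityMeasure μ] {n : ℕ}
    {F : (Fin (n + 1) → Ω) → ℝ} (hF : Measurable F) {C : ℝ} (hC : ∀ x, |F x| ≤ C) :
    ∫ x, F x ∂(Measure.pi fun _ => μ) =
      ∫ y, ∫ a, F (Fin.cons a y) ∂μ ∂(Measure.pi fun _ : Fin n => μ) := by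
  have h := measurePreserving_finCons μ n
  rw [← h.map_eq, integral_map h.measurable.aemeasurable hF.aestronglyMeasurable]
  exact integral_prod_symm _
    (integrable_of_forall_abs_le (hF.comp measurable_finCons) fun p => hC _)

lemma abs_integral_le_of_forall_abs_le (μ : Measure Ω) [IsProbabilityMeasure μ] {f : Ω → ℝ}
    {C : ℝ} (hC : ∀ x, |f x| ≤ C) : |∫ x, f x ∂μ| ≤ C := by
  have := norm_integral_le_of_norm_le_const (μ := μ) (f := f) (ae_of_all _ hC)
  simpa using this

lemma abs_exp_mul_sub_le {t x y C D : ℝ} (hx : |x| ≤ C) (hy : |y| ≤ D) :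
    |Real.exp (t * (x - y))| ≤ Real.exp (|t| * (C + D)) := by
  rw [abs_of_pos (Real.exp_pos _)]
  refine Real.exp_le_exp.2 ((le_abs_self _).trans ?_)
  rw [abs_mul]
  exact mul_le_mul_of_nonneg_left ((abs_sub x y).trans (add_le_add hx hy)) (abs_nonneg t)

/-- A bound on the moment generating function of a function with bounded differences of
independent variables. -/
theorem integral_exp_le_of_bounded_differences (μ : Measure Ω) [IsProbabilityMeasure μ]
    {c : ℝ} (hc : 0 ≤ c) (t : ℝ) {n : ℕ} {f : (Fin n → Ω) → ℝ} (hf : Measurable f) {C : ℝ}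
    (hC : ∀ x, |f x| ≤ C) (hd : ∀ x i a, f (Function.update x i a) ≤ f x + c) :
    ∫ x, Real.exp (t * (f x - ∫ y, f y ∂(Measure.pi fun _ => μ))) ∂(Measure.pi fun _ => μ) ≤
      Real.exp (n * ((c / 2) ^ 2 * t ^ 2 / 2)) := by
  have hΩ : Nonempty Ω := μ.nonempty_of_neZero
  induction n generalizing C with
  | zero =>
    have hconst : ∀ x, f x = ∫ y, f y ∂(Measure.pi fun _ => μ) := fun x => by
      have : ∀ y, f y = f x := fun y => congrArg f (Subsingleton.elim _ _)
      simp [this]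
    have e : ∀ x, f x - ∫ y, f y ∂(Measure.pi fun _ => μ) = 0 := fun x => sub_eq_zero.2 (hconst x)
    simp only [e]
    simp
  | succ n ih =>
    set m := ∫ y, f y ∂(Measure.pi fun _ => μ) with hm
    have hfc : Measurable fun p : Ω × (Fin n → Ω) => f (Fin.cons p.1 p.2) :=
      hf.comp measurable_finCons
    let h : (Fin n → Ω) → ℝ := fun y => ∫ a, f (Fin.cons a y) ∂μ
    have hfa : ∀ y, Measurable fun a => f (Fin.cons a y) := fun y =>
      hfc.comp (measurable_id.prodMk measurable_const)
    have hint : ∀ y, Integrable (fun a => f (Fin.cons a y)) μ := fun y =>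
      integrable_of_forall_abs_le (hfa y) fun a => hC _
    have hh : Measurable h := hfc.stronglyMeasurable.integral_prod_left'.measurable
    have hhC : ∀ y, |h y| ≤ C := fun y => abs_integral_le_of_forall_abs_le μ fun a => hC _
    have hhd : ∀ y i a, h (Function.update y i a) ≤ h y + c := fun y i a => by
      have : ∫ b, f (Fin.cons b (Function.update y i a)) ∂μ ≤
          ∫ b, (f (Fin.cons b y) + c) ∂μ := by
        refine integral_mono (hint _) ((hint y).add (integrable_const c)) fun b => ?_
        have := hd (Fin.cons b y) i.succ a
        rwa [← Fin.cons_update] at this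
      rw [integral_add (hint y) (integrable_const c), integral_const, probReal_univ,
        one_smul] at this
      exact this
    have hmh : m = ∫ y, h y ∂(Measure.pi fun _ => μ) := integral_pi_succ μ hf hC
    have hmC : |m| ≤ C := abs_integral_le_of_forall_abs_le _ hC
    have inner : ∀ y, ∫ a, Real.exp (t * (f (Fin.cons a y) - m)) ∂μ ≤
        Real.exp (t * (h y - m)) * Real.exp ((c / 2) ^ 2 * t ^ 2 / 2) := fun y => by
      have e : ∀ a, Real.exp (t * (f (Fin.cons a y) - m)) =
          Real.exp (t * (h y - m)) * Real.exp (t * (f (Fin.cons a y) - h y)) := fun a => by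
        rw [← Real.exp_add]
        ring_nf
      simp_rw [e]
      rw [integral_const_mul]
      refine mul_le_mul_of_nonneg_left ?_ (Real.exp_pos _).le
      have hbdd : BddBelow (range fun a => f (Fin.cons a y)) :=
        ⟨-C, by rintro _ ⟨a, rfl⟩; exact (abs_le.1 (hC _)).1⟩
      have hmem : ∀ a, f (Fin.cons a y) ∈
          Set.Icc (⨅ a, f (Fin.cons a y)) ((⨅ a, f (Fin.cons a y)) + c) := fun a => by
        refine ⟨ciInf_le hbdd a, ?_⟩
        rw [← sub_le_iff_le_add]
        refine le_ciInf fun b => ?_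
        have := hd (Fin.cons b y) 0 a
        rw [Fin.update_cons_zero] at this
        linarith
      have := (hasSubgaussianMGF_of_mem_Icc (hfa y).aemeasurable (ae_of_all μ hmem)).mgf_le t
      simpa [mgf, abs_of_nonneg hc] using this
    have hexpm : Measurable fun x => Real.exp (t * (f x - m)) := by fun_prop
    rw [integral_pi_succ μ hexpm (fun x => abs_exp_mul_sub_le (hC x) hmC)]
    have hexpc : Measurable fun p : Ω × (Fin n → Ω) => Real.exp (t * (f (Fin.cons p.1 p.2) - m)) :=
      hexpm.comp measurable_finCons
    calc _ ≤ ∫ y, Real.exp (t * (h y - m)) * Real.exp ((c / 2) ^ 2 * t ^ 2 / 2)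
            ∂(Measure.pi fun _ => μ) := by
          refine integral_mono ?_ ?_ inner
          · exact integrable_of_forall_abs_le
              hexpc.stronglyMeasurable.integral_prod_left'.measurable
              fun y => abs_integral_le_of_forall_abs_le μ fun a => abs_exp_mul_sub_le (hC _) hmC
          · exact (integrable_of_forall_abs_le (by fun_prop)
              fun y => abs_exp_mul_sub_le (hhC y) hmC).mul_const _
      _ ≤ Real.exp (n * ((c / 2) ^ 2 * t ^ 2 / 2)) * Real.exp ((c / 2) ^ 2 * t ^ 2 / 2) := by
          rw [integral_mul_const, hmh]
          exact mul_le_mul_of_nonneg_right (ih hh hhC hhd) (Real.exp_pos _).le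
      _ = _ := by
          rw [← Real.exp_add]
          push_cast
          ring_nf

/-- **McDiarmid's inequality** for a bounded function of i.i.d. variables. -/
theorem measureReal_ge_le_of_bounded_differences (μ : Measure Ω) [IsProbabilityMeasure μ]
    {c : ℝ} (hc : 0 ≤ c) {n : ℕ} {f : (Fin n → Ω) → ℝ} (hf : Measurable f) {C : ℝ}
    (hC : ∀ x, |f x| ≤ C) (hd : ∀ x i a, f (Function.update x i a) ≤ f x + c)
    {ε : ℝ} (hε : 0 ≤ ε) :
    (Measure.pi fun _ => μ).real {x | ε ≤ f x - ∫ y, f y ∂(Measure.pi fun _ => μ)} ≤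
      Real.exp (-ε ^ 2 / (2 * (n * (c / 2) ^ 2))) := by
  have h : HasSubgaussianMGF (fun x => f x - ∫ y, f y ∂(Measure.pi fun _ => μ))
      (NNReal.mk (n * (c / 2) ^ 2) (by positivity)) (Measure.pi fun _ => μ) :=
    { integrable_exp_mul := fun t => integrable_of_forall_abs_le (by fun_prop)
        fun x => abs_exp_mul_sub_le (hC x) (abs_integral_le_of_forall_abs_le _ hC)
      mgf_le := fun t => (integral_exp_le_of_bounded_differences μ hc t hf hC hd).trans_eq <| by
        rw [NNReal.coe_mk]
        ring_nf }
  exact h.measure_ge_le hε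

end BoundedDifferences

section UniformDeviation

lemma abs_iSup_le {ι : Type*} [Nonempty ι] {g : ι → ℝ} {C : ℝ} (hg : ∀ i, |g i| ≤ C) :
    |⨆ i, g i| ≤ C := by
  have hb : BddAbove (range g) := ⟨C, by rintro _ ⟨i, rfl⟩; exact (abs_le.1 (hg i)).2⟩
  exact abs_le.2 ⟨(abs_le.1 (hg (Classical.arbitrary ι))).1.trans (le_ciSup hb _),
    ciSup_le fun i => (abs_le.1 (hg i)).2⟩

lemma bddAbove_range_of_abs_le {ι : Type*} {g : ι → ℝ} {C : ℝ} (hg : ∀ i, |g i| ≤ C) :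
    BddAbove (range g) :=
  ⟨C, by rintro _ ⟨i, rfl⟩; exact (abs_le.1 (hg i)).2⟩

lemma sum_update_le {Ω : Type*} {n : ℕ} (h : Fin n → Ω → ℝ) {B : ℝ} (hB : ∀ k a, |h k a| ≤ B)
    (x : Fin n → Ω) (j : Fin n) (a : Ω) :
    ∑ k, h k (Function.update x j a k) ≤ ∑ k, h k (x k) + 2 * B := by
  have : ∑ k, (h k (Function.update x j a k) - h k (x k)) = h j a - h j (x j) := by
    rw [Finset.sum_eq_single j]
    · simp
    · intro k _ hk
      simp [hk]
    · simp
  rw [Finset.sum_sub_distrib] at this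
  have h1 := abs_le.1 (hB j a)
  have h2 := abs_le.1 (hB j (x j))
  linarith

lemma abs_sum_le_mul {n : ℕ} {g : Fin n → ℝ} {B : ℝ} (hB : ∀ k, |g k| ≤ B) :
    |∑ k, g k| ≤ n * B := by
  refine (Finset.abs_sum_le_sum_abs _ _).trans ?_
  simpa using Finset.sum_le_sum fun k (_ : k ∈ Finset.univ) => hB k

variable {Ω ι : Type*} {n : ℕ}

/-- The real sign encoded by a Boolean. -/
def boolSign (b : Bool) : ℝ := if b then 1 else -1

lemma abs_boolSign_mul (b : Bool) (r : ℝ) : |boolSign b * r| = |r| := by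
  cases b <;> simp [boolSign]

/-- The supremum over a class of functions of a signed sum of the values at a sample. -/
noncomputable def signedSup (F : ι → Ω → ℝ) (s : Fin n → Bool) (x : Fin n → Ω) : ℝ :=
  ⨆ i, ∑ k, boolSign (s k) * F i (x k)

/-- The empirical Rademacher complexity of an indexed class of functions. -/
noncomputable def indexedRademacher (F : ι → Ω → ℝ) (x : Fin n → Ω) : ℝ :=
  (n : ℝ)⁻¹ * ((2 ^ n : ℝ)⁻¹ * ∑ s : Fin n → Bool, signedSup F s x)

/-- The two-sample version of the largest deviation. -/
noncomputable def pairSup (F : ι → Ω → ℝ) (z : Fin n → Ω × Ω) : ℝ :=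
  ⨆ i, ∑ k, (F i (z k).2 - F i (z k).1)

variable {F : ι → Ω → ℝ} {B : ℝ}

lemma abs_signedSum_le (hB : ∀ i a, |F i a| ≤ B) (s : Fin n → Bool) (x : Fin n → Ω) (i : ι) :
    |∑ k, boolSign (s k) * F i (x k)| ≤ n * B :=
  abs_sum_le_mul fun k => (abs_boolSign_mul _ _).trans_le (hB i (x k))

lemma abs_pairSum_le (hB : ∀ i a, |F i a| ≤ B) (z : Fin n → Ω × Ω) (i : ι) :
    |∑ k, (F i (z k).2 - F i (z k).1)| ≤ n * (B + B) :=
  abs_sum_le_mul fun _ => (abs_sub _ _).trans (add_le_add (hB i _) (hB i _))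

section Nonempty

variable [Nonempty ι]

lemma abs_signedSup_le (hB : ∀ i a, |F i a| ≤ B) (s : Fin n → Bool) (x : Fin n → Ω) :
    |signedSup F s x| ≤ n * B :=
  abs_iSup_le (abs_signedSum_le hB s x)

lemma signedSup_update_le (hB : ∀ i a, |F i a| ≤ B) (s : Fin n → Bool) (x : Fin n → Ω)
    (j : Fin n) (a : Ω) : signedSup F s (Function.update x j a) ≤ signedSup F s x + 2 * B := by
  refine ciSup_le fun i => ?_
  refine (sum_update_le (fun k a => boolSign (s k) * F i a)
    (fun k a => (abs_boolSign_mul _ _).trans_le (hB i a)) x j a).trans ?_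
  gcongr
  exact le_ciSup (bddAbove_range_of_abs_le (abs_signedSum_le hB s x)) i

lemma abs_indexedRademacher_le (hB : ∀ i a, |F i a| ≤ B) (x : Fin n → Ω) :
    |indexedRademacher F x| ≤ (n : ℝ)⁻¹ * (n * B) := by
  rw [indexedRademacher, abs_mul, abs_mul, abs_of_nonneg (by positivity : (0 : ℝ) ≤ (n : ℝ)⁻¹),
    abs_of_nonneg (by positivity : (0 : ℝ) ≤ (2 ^ n : ℝ)⁻¹)]
  refine mul_le_mul_of_nonneg_left ?_ (by positivity)
  rw [inv_mul_le_iff₀ (by positivity)]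
  refine (Finset.abs_sum_le_sum_abs _ _).trans ?_
  simpa using Finset.sum_le_sum fun s (_ : s ∈ Finset.univ) => abs_signedSup_le hB s x

lemma indexedRademacher_update_le (hB : ∀ i a, |F i a| ≤ B) (x : Fin n → Ω)
    (j : Fin n) (a : Ω) :
    indexedRademacher F (Function.update x j a) ≤ indexedRademacher F x + 2 * B / n := by
  have h : ∑ s : Fin n → Bool, signedSup F s (Function.update x j a) ≤
      ∑ s : Fin n → Bool, signedSup F s x + 2 ^ n * (2 * B) := by
    have := Finset.sum_le_sum fun s (_ : s ∈ (Finset.univ : Finset (Fin n → Bool))) =>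
      signedSup_update_le hB s x j a
    simpa [Finset.sum_add_distrib] using this
  have h2 : (2 ^ n : ℝ)⁻¹ * (2 ^ n * (2 * B)) = 2 * B := by
    rw [← mul_assoc, inv_mul_cancel₀ (by positivity), one_mul]
  calc indexedRademacher F (Function.update x j a)
      ≤ (n : ℝ)⁻¹ * ((2 ^ n : ℝ)⁻¹ *
        (∑ s : Fin n → Bool, signedSup F s x + 2 ^ n * (2 * B))) := by
        unfold indexedRademacher
        gcongr
    _ = _ := by
        rw [mul_add, h2, mul_add, indexedRademacher]
        ring

lemma pairSup_le_signedSup_add (hB : ∀ i a, |F i a| ≤ B) (s : Fin n → Bool)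
    (z : Fin n → Ω × Ω) :
    pairSup F (fun k => if s k then z k else (z k).swap) ≤
      signedSup F s (fun k => (z k).2) + signedSup F (fun k => !(s k)) (fun k => (z k).1) := by
  refine ciSup_le fun i => ?_
  have h1 : ∑ k, boolSign (s k) * F i (z k).2 ≤ signedSup F s (fun k => (z k).2) :=
    le_ciSup (bddAbove_range_of_abs_le (abs_signedSum_le hB s _)) i
  have h2 : ∑ k, boolSign (!(s k)) * F i (z k).1 ≤
      signedSup F (fun k => !(s k)) (fun k => (z k).1) :=
    le_ciSup (bddAbove_range_of_abs_le (abs_signedSum_le hB _ _)) i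
  refine le_trans (le_of_eq ?_) (add_le_add h1 h2)
  rw [← Finset.sum_add_distrib]
  refine Finset.sum_congr rfl fun k _ => ?_
  rcases hs : s k <;> simp [boolSign, hs] <;> ring

end Nonempty

variable [MeasurableSpace Ω]

/-- The largest deviation of the empirical mean from the mean over a class of functions. -/
noncomputable def maxDeviation (μ : Measure Ω) (F : ι → Ω → ℝ) (x : Fin n → Ω) : ℝ :=
  ⨆ i, (∫ a, F i a ∂μ - (n : ℝ)⁻¹ * ∑ k, F i (x k))

lemma abs_deviation_le (μ : Measure Ω) [IsProbabilityMeasure μ] (hB : ∀ i a, |F i a| ≤ B)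
    (x : Fin n → Ω) (i : ι) :
    |∫ a, F i a ∂μ - (n : ℝ)⁻¹ * ∑ k, F i (x k)| ≤ B + (n : ℝ)⁻¹ * (n * B) := by
  refine (abs_sub _ _).trans (add_le_add (abs_integral_le_of_forall_abs_le μ (hB i)) ?_)
  rw [abs_mul, abs_of_nonneg (by positivity : (0 : ℝ) ≤ (n : ℝ)⁻¹)]
  exact mul_le_mul_of_nonneg_left (abs_sum_le_mul fun k => hB i (x k)) (by positivity)

lemma measurable_signedSup [Countable ι] (hF : ∀ i, Measurable (F i)) (s : Fin n → Bool) :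
    Measurable (signedSup F s) :=
  Measurable.iSup fun i => Finset.measurable_sum _ fun k _ =>
    ((hF i).comp (measurable_pi_apply k)).const_mul _

lemma measurable_indexedRademacher [Countable ι] (hF : ∀ i, Measurable (F i)) :
    Measurable (indexedRademacher (n := n) F) :=
  ((Finset.measurable_sum _ fun s _ => measurable_signedSup hF s).const_mul _).const_mul _

lemma measurable_maxDeviation [Countable ι] (μ : Measure Ω) (hF : ∀ i, Measurable (F i)) :
    Measurable (maxDeviation (n := n) μ F) :=
  Measurable.iSup fun i => ((Finset.measurable_sum _ fun k _ =>
    (hF i).comp (measurable_pi_apply k)).const_mul _).const_sub _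

lemma measurable_pairSup [Countable ι] (hF : ∀ i, Measurable (F i)) :
    Measurable (pairSup (n := n) F) :=
  Measurable.iSup fun i => Finset.measurable_sum _ fun k _ =>
    ((hF i).comp (measurable_snd.comp (measurable_pi_apply k))).sub
      ((hF i).comp (measurable_fst.comp (measurable_pi_apply k)))

variable [Nonempty ι]

lemma abs_maxDeviation_le (μ : Measure Ω) [IsProbabilityMeasure μ] (hB : ∀ i a, |F i a| ≤ B)
    (x : Fin n → Ω) : |maxDeviation μ F x| ≤ B + (n : ℝ)⁻¹ * (n * B) :=
  abs_iSup_le (abs_deviation_le μ hB x)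

lemma maxDeviation_update_le (μ : Measure Ω) [IsProbabilityMeasure μ]
    (hB : ∀ i a, |F i a| ≤ B) (x : Fin n → Ω) (j : Fin n) (a : Ω) :
    maxDeviation μ F (Function.update x j a) ≤ maxDeviation μ F x + 2 * B / n := by
  refine ciSup_le fun i => ?_
  have h1 := sum_update_le (fun _ a => -F i a) (fun _ a => (abs_neg _).trans_le (hB i a)) x j a
  simp only [Finset.sum_neg_distrib] at h1
  have h2 := mul_le_mul_of_nonneg_left h1 (by positivity : (0 : ℝ) ≤ (n : ℝ)⁻¹)
  have h3 : ∫ a, F i a ∂μ - (n : ℝ)⁻¹ * ∑ k, F i (x k) ≤ maxDeviation μ F x :=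
    le_ciSup (bddAbove_range_of_abs_le (abs_deviation_le μ hB x)) i
  have h4 : (n : ℝ)⁻¹ * (2 * B) = 2 * B / n := by ring
  rw [mul_add, h4] at h2
  linarith

lemma maxDeviation_le_integral_pairSup [Countable ι] (μ : Measure Ω) [IsProbabilityMeasure μ]
    (hn : 0 < n) (hF : ∀ i, Measurable (F i)) (hB : ∀ i a, |F i a| ≤ B) (x : Fin n → Ω) :
    maxDeviation μ F x ≤
      (n : ℝ)⁻¹ * ∫ y, pairSup F (fun k => (x k, y k)) ∂(Measure.pi fun _ => μ) := by
  refine ciSup_le fun i => ?_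
  have hn' : (0 : ℝ) < n := by exact_mod_cast hn
  have hintk : ∀ k : Fin n, Integrable (fun y : Fin n → Ω => F i (y k)) (Measure.pi fun _ => μ) :=
    fun k => integrable_of_forall_abs_le ((hF i).comp (measurable_pi_apply k)) fun y => hB i _
  have hk : ∀ k : Fin n, ∫ y : Fin n → Ω, F i (y k) ∂(Measure.pi fun _ => μ) = ∫ a, F i a ∂μ :=
    fun k => by
      have h := measurePreserving_eval (fun _ : Fin n => μ) k
      conv_rhs => rw [← h.map_eq, integral_map h.measurable.aemeasurable
        (hF i).aestronglyMeasurable]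
  have hsub : ∀ k : Fin n, Integrable (fun y : Fin n → Ω => F i (y k) - F i (x k))
      (Measure.pi fun _ => μ) := fun k => (hintk k).sub (integrable_const _)
  have hsum : ∫ y : Fin n → Ω, ∑ k, (F i (y k) - F i (x k)) ∂(Measure.pi fun _ => μ) =
      n * ∫ a, F i a ∂μ - ∑ k, F i (x k) := by
    rw [integral_finsetSum _ fun k _ => hsub k]
    simp_rw [integral_sub (hintk _) (integrable_const _), hk]
    simp
  have hle : ∫ y : Fin n → Ω, ∑ k, (F i (y k) - F i (x k)) ∂(Measure.pi fun _ => μ) ≤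
      ∫ y, pairSup F (fun k => (x k, y k)) ∂(Measure.pi fun _ => μ) := by
    refine integral_mono (integrable_finsetSum _ fun k _ => hsub k)
      (integrable_of_forall_abs_le ((measurable_pairSup hF).comp (by fun_prop))
        fun y => abs_iSup_le (abs_pairSum_le hB _)) fun y => ?_
    exact le_ciSup (bddAbove_range_of_abs_le (abs_pairSum_le hB fun k => (x k, y k))) i
  rw [hsum] at hle
  refine le_trans (le_of_eq ?_) (mul_le_mul_of_nonneg_left hle (inv_nonneg.2 hn'.le))
  rw [mul_sub, ← mul_assoc, inv_mul_cancel₀ hn'.ne', one_mul]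

/-- Symmetrization: the expected largest deviation is at most twice the expected empirical
Rademacher complexity. -/
theorem integral_maxDeviation_le [Countable ι] (μ : Measure Ω) [IsProbabilityMeasure μ]
    (hn : 0 < n) (hF : ∀ i, Measurable (F i)) (hB : ∀ i a, |F i a| ≤ B) :
    ∫ x : Fin n → Ω, maxDeviation μ F x ∂(Measure.pi fun _ => μ) ≤
      2 * ∫ x : Fin n → Ω, indexedRademacher F x ∂(Measure.pi fun _ => μ) := by
  let ν : Measure (Fin n → Ω) := Measure.pi fun _ => μ
  let ν₂ : Measure (Fin n → Ω × Ω) := Measure.pi fun _ => μ.prod μ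
  have hpair : Integrable (pairSup F) ν₂ := integrable_of_forall_abs_le (measurable_pairSup hF)
    fun z => abs_iSup_le (abs_pairSum_le hB z)
  have hT : ∀ s, Integrable (signedSup F s) ν := fun s =>
    integrable_of_forall_abs_le (measurable_signedSup hF s) (abs_signedSup_le hB s)
  have hmp := measurePreserving_arrowProdEquivProdArrow Ω Ω (Fin n) (fun _ => μ) (fun _ => μ)
  have mz : Measurable fun p : (Fin n → Ω) × (Fin n → Ω) => fun k => (p.1 k, p.2 k) := by fun_prop
  have hpair' : ∫ x, ∫ y, pairSup F (fun k => (x k, y k)) ∂ν ∂ν = ∫ z, pairSup F z ∂ν₂ := by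
    have hi : Integrable (fun p : (Fin n → Ω) × (Fin n → Ω) => pairSup F fun k => (p.1 k, p.2 k))
        (ν.prod ν) := integrable_of_forall_abs_le ((measurable_pairSup hF).comp mz)
          fun p => abs_iSup_le (abs_pairSum_le hB _)
    rw [← integral_prod _ hi]
    exact hmp.integral_comp' (g := fun p => pairSup F fun k => (p.1 k, p.2 k)) |>.symm
  have hstep : ∫ x, maxDeviation μ F x ∂ν ≤ (n : ℝ)⁻¹ * ∫ z, pairSup F z ∂ν₂ := by
    rw [← hpair', ← integral_const_mul]
    refine integral_mono (integrable_of_forall_abs_le (measurable_maxDeviation μ hF)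
      (abs_maxDeviation_le μ hB)) (Integrable.const_mul ?_ _)
      (maxDeviation_le_integral_pairSup μ hn hF hB)
    exact integrable_of_forall_abs_le
      ((measurable_pairSup hF).comp mz).stronglyMeasurable.integral_prod_right'.measurable
      fun x => abs_integral_le_of_forall_abs_le _ fun y => abs_iSup_le (abs_pairSum_le hB _)
  have hsign : ∀ s : Fin n → Bool, ∫ z, pairSup F z ∂ν₂ ≤
      ∫ x, signedSup F s x ∂ν + ∫ x, signedSup F (fun k => !(s k)) x ∂ν := by
    intro s
    have hsw : MeasurePreserving (fun (z : Fin n → Ω × Ω) k => if s k then z k else (z k).swap)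
        ν₂ ν₂ := by
      refine measurePreserving_pi (f := fun k (p : Ω × Ω) => if s k then p else p.swap)
        _ _ fun k => ?_
      cases s k
      · simpa using Measure.measurePreserving_swap
      · simpa using! MeasurePreserving.id (μ.prod μ)
    have h2 : MeasurePreserving (fun (z : Fin n → Ω × Ω) k => (z k).2) ν₂ ν :=
      measurePreserving_pi (f := fun _ => Prod.snd) _ _ fun k => measurePreserving_snd
    have h1 : MeasurePreserving (fun (z : Fin n → Ω × Ω) k => (z k).1) ν₂ ν :=
      measurePreserving_pi (f := fun _ => Prod.fst) _ _ fun k => measurePreserving_fst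
    have e2 : ∫ z, signedSup F s (fun k => (z k).2) ∂ν₂ = ∫ x, signedSup F s x ∂ν := by
      conv_rhs => rw [← h2.map_eq, integral_map h2.measurable.aemeasurable
        (measurable_signedSup hF _).aestronglyMeasurable]
    have e1 : ∫ z, signedSup F (fun k => !(s k)) (fun k => (z k).1) ∂ν₂ =
        ∫ x, signedSup F (fun k => !(s k)) x ∂ν := by
      conv_rhs => rw [← h1.map_eq, integral_map h1.measurable.aemeasurable
        (measurable_signedSup hF _).aestronglyMeasurable]
    have i2 := h2.integrable_comp_of_integrable (hT s)
    have i1 := h1.integrable_comp_of_integrable (hT fun k => !(s k))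
    rw [← e1, ← e2]
    conv_lhs => rw [← hsw.map_eq, integral_map hsw.measurable.aemeasurable
        (measurable_pairSup hF).aestronglyMeasurable]
    refine (integral_mono (hsw.integrable_comp_of_integrable hpair) (i2.add i1)
      (pairSup_le_signedSup_add hB s)).trans_eq ?_
    exact integral_add i2 i1
  have hflip : ∑ s : Fin n → Bool, ∫ x, signedSup F (fun k => !(s k)) x ∂ν =
      ∑ s : Fin n → Bool, ∫ x, signedSup F s x ∂ν := by
    refine Fintype.sum_bijective (fun (s : Fin n → Bool) k => !(s k)) ?_ _ _ fun s => rfl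
    exact Function.Involutive.bijective fun s => by simp
  have hsum : 2 ^ n * ∫ z, pairSup F z ∂ν₂ ≤ 2 * ∑ s : Fin n → Bool, ∫ x, signedSup F s x ∂ν := by
    have := Finset.sum_le_sum fun s (_ : s ∈ (Finset.univ : Finset (Fin n → Bool))) => hsign s
    rw [Finset.sum_add_distrib, hflip] at this
    simp only [Finset.sum_const, Finset.card_univ, Fintype.card_pi, Fintype.card_bool,
      Finset.prod_const, Fintype.card_fin, nsmul_eq_mul, Nat.cast_pow, Nat.cast_ofNat] at this
    linarith
  have hR : ∫ x : Fin n → Ω, indexedRademacher F x ∂ν =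
      (n : ℝ)⁻¹ * ((2 ^ n : ℝ)⁻¹ * ∑ s : Fin n → Bool, ∫ x, signedSup F s x ∂ν) := by
    unfold indexedRademacher
    rw [integral_const_mul, integral_const_mul, integral_finsetSum _ fun s _ => hT s]
  show ∫ x, maxDeviation μ F x ∂ν ≤ 2 * ∫ x, indexedRademacher F x ∂ν
  rw [hR]
  refine hstep.trans ?_
  rw [mul_left_comm 2]
  refine mul_le_mul_of_nonneg_left ?_ (by positivity)
  rw [mul_left_comm 2, ← div_eq_inv_mul, le_div_iff₀' (by positivity)]
  exact hsum

/-- A uniform deviation bound in terms of the empirical Rademacher complexity. -/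
theorem le_measure_maxDeviation_le [Countable ι] (μ : Measure Ω) [IsProbabilityMeasure μ]
    (hn : 0 < n) (hF : ∀ i, Measurable (F i)) (hB : ∀ i a, |F i a| ≤ B) (hB0 : 0 < B)
    {δ : ℝ} (hδ0 : 0 < δ) (hδ1 : δ ≤ 1) :
    ENNReal.ofReal (1 - 2 * δ) ≤ (Measure.pi fun _ : Fin n => μ)
      {x | maxDeviation μ F x ≤
        2 * indexedRademacher F x + 3 * B * Real.sqrt (2 * Real.log δ⁻¹ / n)} := by
  have hn' : (0 : ℝ) < n := by exact_mod_cast hn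
  set ν : Measure (Fin n → Ω) := Measure.pi fun _ => μ
  set r := Real.sqrt (2 * Real.log δ⁻¹ / n) with hr
  have hlog : 0 ≤ Real.log δ⁻¹ := Real.log_nonneg ((one_le_inv₀ hδ0).2 hδ1)
  have ht : 0 ≤ B * r := by positivity
  have htail : Real.exp (-(B * r) ^ 2 / (2 * (n * (2 * B / n / 2) ^ 2))) = δ := by
    have : -(B * r) ^ 2 / (2 * (n * (2 * B / n / 2) ^ 2)) = -Real.log δ⁻¹ := by
      rw [mul_pow, hr, Real.sq_sqrt (by positivity)]
      field_simp
    rw [this, Real.log_inv, neg_neg, Real.exp_log hδ0]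
  have hS := measureReal_ge_le_of_bounded_differences μ (by positivity : 0 ≤ 2 * B / n)
    (measurable_maxDeviation (n := n) μ hF) (abs_maxDeviation_le μ hB)
    (maxDeviation_update_le μ hB) ht
  have hR := measureReal_ge_le_of_bounded_differences μ (by positivity : 0 ≤ 2 * B / n)
    (measurable_indexedRademacher (n := n) hF).neg
    (fun x => (abs_neg _).trans_le (abs_indexedRademacher_le hB x))
    (fun x j a => by
      have := indexedRademacher_update_le hB (Function.update x j a) j (x j)
      rw [Function.update_idem, Function.update_eq_self] at this
      show -indexedRademacher F _ ≤ -indexedRademacher F x + 2 * B / n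
      linarith) ht
  rw [htail] at hS hR
  have hsym := integral_maxDeviation_le μ hn hF hB
  set A : Set (Fin n → Ω) := {x | B * r ≤ maxDeviation μ F x - ∫ y, maxDeviation μ F y ∂ν}
  set D : Set (Fin n → Ω) :=
    {x | B * r ≤ -indexedRademacher F x - ∫ y, -indexedRademacher F y ∂ν}
  have hAm : MeasurableSet A :=
    measurableSet_le measurable_const ((measurable_maxDeviation μ hF).sub_const _)
  have hDm : MeasurableSet D :=
    measurableSet_le measurable_const ((measurable_indexedRademacher hF).neg.sub_const _)
  have hsub : (A ∪ D)ᶜ ⊆ {x | maxDeviation μ F x ≤ 2 * indexedRademacher F x + 3 * B * r} := by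
    intro x hx
    rw [mem_compl_iff, mem_union, not_or] at hx
    obtain ⟨hxA, hxD⟩ := hx
    simp only [A, D, mem_ofPred_eq, not_le, integral_neg] at hxA hxD
    show maxDeviation μ F x ≤ 2 * indexedRademacher F x + 3 * B * r
    change _ ≤ 2 * ∫ x, indexedRademacher F x ∂ν at hsym
    linarith
  refine le_trans ?_ (measure_mono hsub)
  rw [← ofReal_measureReal]
  refine ENNReal.ofReal_le_ofReal ?_
  rw [probReal_compl_eq_one_sub (hAm.union hDm)]
  have := measureReal_union_le (μ := ν) A D
  change ν.real A ≤ δ at hS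
  change ν.real D ≤ δ at hR
  linarith

end UniformDeviation

section Uniform

/-- A class of continuous functions contains a sequence that is uniformly dense on a compact set. -/
lemma exists_seq_approx_on_compact {E : Type*} [MetricSpace E] {K : Set E} (hK : IsCompact K)
    {C : Set (E → ℝ)} (hne : C.Nonempty) (hC : ∀ φ ∈ C, Continuous φ) :
    ∃ u : ℕ → E → ℝ, (∀ i, u i ∈ C) ∧
      ∀ φ ∈ C, ∀ ε > 0, ∃ i, ∀ x ∈ K, |φ x - u i x| ≤ ε := by
  have : CompactSpace K := isCompact_iff_compactSpace.1 hK
  let res : C → C(K, ℝ) := fun φ => ⟨fun x => φ.1 x, (hC φ.1 φ.2).comp continuous_subtype_val⟩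
  have : Nonempty C := hne.to_subtype
  choose v hv using fun i => (TopologicalSpace.denseSeq (range res) i).2
  refine ⟨fun i => (v i).1, fun i => (v i).2, fun φ hφ ε hε => ?_⟩
  obtain ⟨i, hi⟩ := (TopologicalSpace.denseRange_denseSeq (range res)).exists_dist_lt
    ⟨res ⟨φ, hφ⟩, mem_range_self _⟩ hε
  refine ⟨i, fun x hx => ?_⟩
  rw [Subtype.dist_eq, ← hv i] at hi
  exact (ContinuousMap.dist_apply_le_dist ⟨x, hx⟩).trans hi.le

variable {d n : ℕ} {lam : Fin d → ℝ}

lemma abs_euclidean_apply_le (x : EuclideanSpace ℝ (Fin d)) (j : Fin d) : |x j| ≤ ‖x‖ :=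
  PiLp.norm_apply_le x j

lemma continuous_of_mem_Flam {φ : EuclideanSpace ℝ (Fin d) → ℝ} (hφ : φ ∈ Flam lam) :
    Continuous φ := by
  obtain ⟨f, g, hf, hg, h⟩ := hφ
  rw [funext h]
  have := hf.continuous
  have := fun j => (hg j).continuous
  fun_prop

lemma abs_sub_le_of_mem_Flam (hlam : ∀ j, 0 ≤ lam j) {φ : EuclideanSpace ℝ (Fin d) → ℝ}
    (hφ : φ ∈ Flam lam) (x : EuclideanSpace ℝ (Fin d)) :
    |φ x - φ 0| ≤ ‖x‖ * (1 + Real.sqrt (∑ j, lam j ^ 2)) := by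
  obtain ⟨f, g, hf, hg, h⟩ := hφ
  have hf' : |f x - f 0| ≤ ‖x‖ := by simpa [Real.dist_eq] using hf.dist_le_mul x 0
  have hg' : ∀ j, |g j (x j) - g j 0| ≤ |x j| := fun j => by
    simpa [Real.dist_eq] using (hg j).dist_le_mul (x j) 0
  have e : φ x - φ 0 = (f x - f 0) + ∑ j, lam j * (g j (x j) - g j 0) := by
    simp only [h, mul_sub, Finset.sum_sub_distrib, PiLp.zero_apply]
    ring
  have hsum : |∑ j, lam j * (g j (x j) - g j 0)| ≤ ∑ j, lam j * |x j| := by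
    refine (Finset.abs_sum_le_sum_abs _ _).trans (Finset.sum_le_sum fun j _ => ?_)
    rw [abs_mul, abs_of_nonneg (hlam j)]
    exact mul_le_mul_of_nonneg_left (hg' j) (hlam j)
  have hcs : ∑ j, lam j * |x j| ≤ Real.sqrt (∑ j, lam j ^ 2) * ‖x‖ := by
    have := Real.sum_mul_le_sqrt_mul_sqrt Finset.univ lam fun j => |x j|
    simpa [EuclideanSpace.norm_eq] using this
  rw [e]
  refine (abs_add_le _ _).trans ?_
  linarith

lemma Flam_nonempty (lam : Fin d → ℝ) : (Flam lam).Nonempty :=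
  ⟨fun _ => 0, fun _ => 0, fun _ _ => 0, LipschitzWith.const' 0, fun _ => LipschitzWith.const' 0,
    by simp⟩

/-- The empirical Rademacher complexity of a bounded subclass of `Flam lam`, centred at `0`, is
at most that of `Flam lam`. -/
lemma indexedRademacher_le_rademacherComplexity {ι : Type*} [Nonempty ι]
    {u : ι → EuclideanSpace ℝ (Fin d) → ℝ} (hu : ∀ i, u i ∈ Flam lam)
    {x : Fin n → EuclideanSpace ℝ (Fin d)} {B : ℝ}
    (hB : ∀ φ ∈ Flam lam, ∀ k, |φ (x k) - φ 0| ≤ B) :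
    indexedRademacher (fun i a => u i a - u i 0) x ≤ rademacherComplexity lam x := by
  unfold indexedRademacher rademacherComplexity
  gcongr with s
  refine ciSup_le fun i => le_csSup ⟨n * B, ?_⟩ ⟨u i, hu i, rfl⟩
  rintro _ ⟨φ, hφ, rfl⟩
  exact (le_abs_self _).trans
    (abs_sum_le_mul fun k => (abs_boolSign_mul _ _).trans_le (hB φ hφ k))

lemma ae_pi_forall_mem {Ω : Type*} [MeasurableSpace Ω] (P : Measure Ω) [IsProbabilityMeasure P]
    {K : Set Ω} (hP : P Kᶜ = 0) : ∀ᵐ x ∂(Measure.pi fun _ : Fin n => P), ∀ k, x k ∈ K :=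
  ae_all_iff.2 fun k =>
    (measurePreserving_eval (fun _ : Fin n => P) k).quasiMeasurePreserving.ae (mem_ae_iff.2 hP)

/-- Uniform deviations over `Flam lam` for a distribution concentrated on a ball. -/
theorem le_measure_forall_mem_Flam (hn : 0 < n) {M : ℝ} (hM : 0 < M) (hlam : ∀ j, 0 ≤ lam j)
    (P : Measure (EuclideanSpace ℝ (Fin d))) [IsProbabilityMeasure P]
    (hsupp : P (Metric.closedBall 0 M)ᶜ = 0) {δ : ℝ} (hδ0 : 0 < δ) (hδ1 : δ ≤ 1) :
    ENNReal.ofReal (1 - 2 * δ) ≤ (Measure.pi fun _ : Fin n => P)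
      {x | (∀ k, x k ∈ Metric.closedBall 0 M) ∧ ∀ φ ∈ Flam lam,
        ∫ a, φ a ∂P - (n : ℝ)⁻¹ * ∑ k, φ (x k) ≤ 2 * rademacherComplexity lam x +
          3 * M * (1 + Real.sqrt (∑ j, lam j ^ 2)) * Real.sqrt (2 * Real.log δ⁻¹ / n)} := by
  have hn' : (0 : ℝ) < n := by exact_mod_cast hn
  set K : Set (EuclideanSpace ℝ (Fin d)) := Metric.closedBall 0 M
  have hK : IsCompact K := isCompact_closedBall 0 M
  have hKm : MeasurableSet K := hK.measurableSet
  set B := M * (1 + Real.sqrt (∑ j, lam j ^ 2)) with hBdef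
  have hBK : ∀ φ ∈ Flam lam, ∀ a ∈ K, |φ a - φ 0| ≤ B := fun φ hφ a ha =>
    (abs_sub_le_of_mem_Flam hlam hφ a).trans
      (mul_le_mul_of_nonneg_right (mem_closedBall_zero_iff.1 ha) (by positivity))
  obtain ⟨u, huF, hu⟩ := exists_seq_approx_on_compact hK (Flam_nonempty lam)
    fun φ hφ => continuous_of_mem_Flam hφ
  let F : ℕ → EuclideanSpace ℝ (Fin d) → ℝ := fun i => K.indicator fun a => u i a - u i 0
  have hFm : ∀ i, Measurable (F i) := fun i =>
    ((continuous_of_mem_Flam (huF i)).measurable.sub_const _).indicator hKm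
  have hFK : ∀ i, ∀ a ∈ K, F i a = u i a - u i 0 := fun i a ha => indicator_of_mem ha _
  have hFB : ∀ i a, |F i a| ≤ B := fun i a => by
    by_cases ha : a ∈ K
    · rw [hFK i a ha]
      exact hBK _ (huF i) a ha
    · simp only [F, indicator_of_notMem ha, abs_zero]
      positivity
  have hPK : ∀ᵐ a ∂P, a ∈ K := mem_ae_iff.2 hsupp
  have hint : ∀ φ ∈ Flam lam, Integrable φ P := fun φ hφ => by
    have hb : Integrable (fun a => φ a - φ 0) P :=
      Integrable.of_bound ((continuous_of_mem_Flam hφ).measurable.sub_const _).aestronglyMeasurable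
        B (hPK.mono fun a ha => hBK φ hφ a ha)
    exact (hb.add (integrable_const (φ 0))).congr (ae_of_all _ fun a => sub_add_cancel _ _)
  have key := le_measure_maxDeviation_le P hn hFm hFB (by positivity : 0 < B) hδ0 hδ1
  refine key.trans (measure_mono_ae ?_)
  filter_upwards [ae_pi_forall_mem P hsupp] with x hxK hx
  refine ⟨hxK, fun φ hφ => ?_⟩
  have hR : indexedRademacher F x ≤ rademacherComplexity lam x := by
    have h := indexedRademacher_le_rademacherComplexity huF (fun φ hφ k => hBK φ hφ _ (hxK k))
    refine le_trans (le_of_eq ?_) h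
    simp only [indexedRademacher, signedSup, hFK _ _ (hxK _)]
  have hdev : ∀ i, ∫ a, u i a ∂P - (n : ℝ)⁻¹ * ∑ k, u i (x k) ≤ maxDeviation P F x := fun i => by
    refine le_trans (le_of_eq ?_)
      (le_ciSup (bddAbove_range_of_abs_le (abs_deviation_le P hFB x)) i)
    have h1 : ∫ a, F i a ∂P = ∫ a, u i a ∂P - u i 0 := by
      rw [integral_congr_ae (hPK.mono fun a ha => hFK i a ha),
        integral_sub (hint _ (huF i)) (integrable_const _)]
      simp
    have h2 : (n : ℝ)⁻¹ * ∑ k, F i (x k) = (n : ℝ)⁻¹ * ∑ k, u i (x k) - u i 0 := by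
      simp only [hFK i _ (hxK _), Finset.sum_sub_distrib, Finset.sum_const, Finset.card_univ,
        Fintype.card_fin, nsmul_eq_mul, mul_sub]
      rw [← mul_assoc, inv_mul_cancel₀ hn'.ne', one_mul]
    rw [h1, h2]
    ring
  refine le_of_forall_pos_le_add fun ε hε => ?_
  obtain ⟨i, hi⟩ := hu φ hφ (ε / 2) (half_pos hε)
  have h1 : ∫ a, φ a ∂P ≤ ∫ a, u i a ∂P + ε / 2 := by
    have : ∫ a, φ a ∂P ≤ ∫ a, (u i a + ε / 2) ∂P :=
      integral_mono_ae (hint φ hφ) ((hint _ (huF i)).add (integrable_const _))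
        (hPK.mono fun a ha => by
          have := (abs_le.1 (hi a ha)).2
          show φ a ≤ u i a + ε / 2
          linarith)
    rw [integral_add (hint _ (huF i)) (integrable_const _)] at this
    simpa using this
  have h2 : (n : ℝ)⁻¹ * ∑ k, u i (x k) ≤ (n : ℝ)⁻¹ * ∑ k, φ (x k) + ε / 2 := by
    have : ∑ k, u i (x k) ≤ ∑ k, (φ (x k) + ε / 2) := Finset.sum_le_sum fun k _ => by
      have := (abs_le.1 (hi _ (hxK k))).1
      linarith
    have := mul_le_mul_of_nonneg_left this (inv_nonneg.2 hn'.le)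
    simpa [Finset.sum_add_distrib, mul_add, hn'.ne'] using this
  have h3 := hdev i
  change maxDeviation P F x ≤ _ at hx
  have h4 : 3 * B = 3 * M * (1 + Real.sqrt (∑ j, lam j ^ 2)) := by rw [hBdef]; ring
  rw [h4] at hx
  linarith

end Uniform

section Empirical

variable {E : Type*} [MeasurableSpace E] {n : ℕ}

lemma isProbabilityMeasure_empMeasure (hn : 0 < n) (x : Fin n → E) :
    IsProbabilityMeasure (empMeasure x) := ⟨by
  have : (n : ℝ≥0∞) ≠ 0 := by exact_mod_cast hn.ne'
  simp [empMeasure, ENNReal.inv_mul_cancel this]⟩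

lemma empMeasure_compl_eq_zero {x : Fin n → E} {K : Set E} (hK : MeasurableSet K)
    (hx : ∀ k, x k ∈ K) : empMeasure x Kᶜ = 0 := by
  simp [empMeasure, Measure.dirac_apply' _ hK.compl, hx]

lemma integral_empMeasure (x : Fin n → E) {f : E → ℝ} (hf : StronglyMeasurable f) :
    ∫ a, f a ∂(empMeasure x) = (n : ℝ)⁻¹ * ∑ k, f (x k) := by
  have hi : ∀ k, Integrable f (Measure.dirac (x k)) := fun k => by
    refine ⟨hf.aestronglyMeasurable, ?_⟩
    rw [HasFiniteIntegral, lintegral_dirac' _ hf.enorm]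
    exact enorm_lt_top
  rw [empMeasure, integral_smul_measure, integral_finsetSum_measure fun k _ => hi k]
  simp [integral_dirac' _ _ hf]

lemma integrable_norm_of_compl_closedBall {E : Type*} [MeasurableSpace E] [NormedAddCommGroup E]
    [BorelSpace E] {P : Measure E} [IsProbabilityMeasure P] {M : ℝ}
    (hP : P (Metric.closedBall 0 M)ᶜ = 0) : Integrable (fun a => ‖a‖) P :=
  have h : ∀ᵐ a ∂P, a ∈ Metric.closedBall 0 M := mem_ae_iff.2 hP
  Integrable.of_bound measurable_norm.aestronglyMeasurable M
    (h.mono fun a ha => by simpa using ha)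

end Empirical

section MPW

variable {d : ℕ} {lam : Fin d → ℝ}

lemma measurable_euclidean_apply (j : Fin d) :
    Measurable fun x : EuclideanSpace ℝ (Fin d) => x j := by fun_prop

lemma isProbabilityMeasure_marginal (μ : Measure (EuclideanSpace ℝ (Fin d)))
    [IsProbabilityMeasure μ] (j : Fin d) : IsProbabilityMeasure (μ.map fun x => x j) :=
  Measure.isProbabilityMeasure_map (measurable_euclidean_apply j).aemeasurable

lemma integrable_norm_marginal {μ : Measure (EuclideanSpace ℝ (Fin d))}
    (hμ : Integrable (fun a => ‖a‖) μ) (j : Fin d) :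
    Integrable (fun a => ‖a‖) (μ.map fun x => x j) := by
  rw [integrable_map_measure measurable_norm.aestronglyMeasurable
    (measurable_euclidean_apply j).aemeasurable]
  refine hμ.mono (by fun_prop) (ae_of_all _ fun x => ?_)
  simpa using abs_euclidean_apply_le x j

lemma marginal_compl_closedBall_eq_zero {μ : Measure (EuclideanSpace ℝ (Fin d))} {M : ℝ}
    (hμ : μ (Metric.closedBall 0 M)ᶜ = 0) (j : Fin d) :
    (μ.map fun x => x j) (Metric.closedBall 0 M)ᶜ = 0 := by
  rw [Measure.map_apply (measurable_euclidean_apply j)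
    Metric.isClosed_closedBall.measurableSet.compl]
  rw [preimage_compl]
  refine measure_mono_null (compl_subset_compl.2 fun x hx => ?_) hμ
  rw [mem_preimage, mem_closedBall_zero_iff]
  rw [mem_closedBall_zero_iff] at hx
  exact (abs_euclidean_apply_le x j).trans hx

/-- The triangle inequality for the marginally-penalized Wasserstein distance. -/
theorem MPW_triangle (hlam : ∀ j, 0 ≤ lam j) {μ ν ρ : Measure (EuclideanSpace ℝ (Fin d))}
    [IsProbabilityMeasure μ] [IsProbabilityMeasure ν] [IsProbabilityMeasure ρ]
    (hμ : Integrable (fun x => ‖x‖) μ) (hν : Integrable (fun x => ‖x‖) ν)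
    (hρ : Integrable (fun x => ‖x‖) ρ) :
    MPW lam μ ρ ≤ MPW lam μ ν + MPW lam ν ρ := by
  have h1 := W1_triangle hμ hν hρ
  have h2 : ∀ j, lam j * W1 (μ.map fun x => x j) (ρ.map fun x => x j) ≤
      lam j * W1 (μ.map fun x => x j) (ν.map fun x => x j) +
        lam j * W1 (ν.map fun x => x j) (ρ.map fun x => x j) := fun j => by
    have := isProbabilityMeasure_marginal μ j
    have := isProbabilityMeasure_marginal ν j
    have := isProbabilityMeasure_marginal ρ j
    rw [← mul_add]
    exact mul_le_mul_of_nonneg_left (W1_triangle (integrable_norm_marginal hμ j)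
      (integrable_norm_marginal hν j) (integrable_norm_marginal hρ j)) (hlam j)
  have h3 := Finset.sum_le_sum fun j (_ : j ∈ Finset.univ) => h2 j
  rw [Finset.sum_add_distrib] at h3
  unfold MPW
  linarith

/-- A `1`-Lipschitz function is integrable against a measure with finite first moment. -/
lemma LipschitzWith.integrable_of_integrable_norm {E : Type*} [MeasurableSpace E]
    [NormedAddCommGroup E] [BorelSpace E] {μ : Measure E} [IsFiniteMeasure μ]
    (hμ : Integrable (fun a => ‖a‖) μ) {f : E → ℝ} (hf : LipschitzWith 1 f) : Integrable f μ := by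
  refine ((integrable_const |f 0|).add hμ).mono' hf.continuous.measurable.aestronglyMeasurable
    (ae_of_all _ fun a => ?_)
  have h1 : |f a - f 0| ≤ ‖a‖ := by simpa [Real.dist_eq] using hf.dist_le_mul a 0
  have h2 := abs_add_le (f 0) (f a - f 0)
  rw [add_sub_cancel] at h2
  show |f a| ≤ |f 0| + ‖a‖
  linarith

/-- For measures concentrated on a ball, the marginally-penalized Wasserstein distance is
dominated by the integral probability metric of `Flam lam`. -/
theorem MPW_le_of_forall_mem_Flam (hlam : ∀ j, 0 ≤ lam j) {M : ℝ}
    {P Q : Measure (EuclideanSpace ℝ (Fin d))} [IsProbabilityMeasure P] [IsProbabilityMeasure Q]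
    (hP : P (Metric.closedBall 0 M)ᶜ = 0) (hQ : Q (Metric.closedBall 0 M)ᶜ = 0) {b : ℝ}
    (hb : ∀ φ ∈ Flam lam, ∫ a, φ a ∂P - ∫ a, φ a ∂Q ≤ b) : MPW lam P Q ≤ b := by
  have hS : 0 < 1 + ∑ j, lam j :=
    add_pos_of_pos_of_nonneg one_pos (Finset.sum_nonneg fun j _ => hlam j)
  refine le_of_forall_pos_le_add fun ε hε => ?_
  have hε' : 0 < ε / (1 + ∑ j, lam j) := div_pos hε hS
  obtain ⟨f, hf, hfle⟩ := exists_lipschitz_W1_le (isCompact_closedBall 0 M) P Q hP hQ hε'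
  have hg : ∀ j, ∃ g : ℝ → ℝ, LipschitzWith 1 g ∧
      W1 (P.map fun x => x j) (Q.map fun x => x j) ≤
        ∫ x, g (x j) ∂P - ∫ x, g (x j) ∂Q + ε / (1 + ∑ j, lam j) := fun j => by
    have := isProbabilityMeasure_marginal P j
    have := isProbabilityMeasure_marginal Q j
    obtain ⟨g, hg, hgle⟩ := exists_lipschitz_W1_le (isCompact_closedBall 0 M)
      (P.map fun x => x j) (Q.map fun x => x j) (marginal_compl_closedBall_eq_zero hP j)
      (marginal_compl_closedBall_eq_zero hQ j) hε'
    rw [integral_map (measurable_euclidean_apply j).aemeasurable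
        hg.continuous.measurable.aestronglyMeasurable,
      integral_map (measurable_euclidean_apply j).aemeasurable
        hg.continuous.measurable.aestronglyMeasurable] at hgle
    exact ⟨g, hg, hgle⟩
  choose g hg hgle using hg
  have hint : ∀ (μ : Measure (EuclideanSpace ℝ (Fin d))) [IsProbabilityMeasure μ],
      μ (Metric.closedBall 0 M)ᶜ = 0 → ∫ x, (f x + ∑ j, lam j * g j (x j)) ∂μ =
        ∫ x, f x ∂μ + ∑ j, lam j * ∫ x, g j (x j) ∂μ := fun μ _ hμ => by
    have hn := integrable_norm_of_compl_closedBall hμ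
    have hgi : ∀ j, Integrable (fun x => lam j * g j (x j)) μ := fun j => by
      have := isProbabilityMeasure_marginal μ j
      exact (((hg j).integrable_of_integrable_norm (integrable_norm_marginal hn j)).comp_measurable
        (measurable_euclidean_apply j)).const_mul _
    rw [integral_add (hf.integrable_of_integrable_norm hn)
        (integrable_finsetSum _ fun j _ => hgi j),
      integral_finsetSum _ fun j _ => hgi j]
    simp_rw [integral_const_mul]
  have hφ := hb _ ⟨f, g, hf, hg, fun _ => rfl⟩
  rw [hint P hP, hint Q hQ] at hφ
  have hsum : ∑ j, lam j * W1 (P.map fun x => x j) (Q.map fun x => x j) ≤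
      ∑ j, lam j * ∫ x, g j (x j) ∂P - ∑ j, lam j * ∫ x, g j (x j) ∂Q +
        (∑ j, lam j) * (ε / (1 + ∑ j, lam j)) := by
    rw [Finset.sum_mul, ← Finset.sum_sub_distrib, ← Finset.sum_add_distrib]
    refine Finset.sum_le_sum fun j _ => ?_
    rw [← mul_sub, ← mul_add]
    exact mul_le_mul_of_nonneg_left (hgle j) (hlam j)
  have hεeq : ε / (1 + ∑ j, lam j) + (∑ j, lam j) * (ε / (1 + ∑ j, lam j)) = ε := by
    field_simp
  unfold MPW
  linarith

end MPW

/-- Generalization bound for the MPW loss: if `P_X` is supported in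
the ball `B_M`, then for any `δ ∈ (0, 1/2)`, with probability at least `1 - 2δ` over
the i.i.d. sample, simultaneously for every probability measure `ν` with finite first
moment, `D(P_X, ν) ≤ D(P̂ⁿ, ν) + 2 R̂_n(F_λ) + 3M(1 + ‖λ‖₂)√(2 log(1/δ)/n)`. -/
theorem mpw_generalization_bound {d n : ℕ} (hn : 0 < n) (M : ℝ) (hM : 0 < M)
    (lam : Fin d → ℝ) (hlam : ∀ j, 0 ≤ lam j)
    (P : Measure (EuclideanSpace ℝ (Fin d))) [IsProbabilityMeasure P]
    (hsupp : P (Metric.closedBall 0 M)ᶜ = 0)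
    (δ : ℝ) (hδ : δ ∈ Set.Ioo (0 : ℝ) (1 / 2)) :
    ENNReal.ofReal (1 - 2 * δ) ≤
      (Measure.pi fun _ : Fin n => P)
        {x : Fin n → EuclideanSpace ℝ (Fin d) |
          ∀ (ν : Measure (EuclideanSpace ℝ (Fin d))), IsProbabilityMeasure ν →
            FiniteFirstMoment ν →
            MPW lam P ν ≤ MPW lam (empMeasure x) ν + 2 * rademacherComplexity lam x +
              3 * M * (1 + Real.sqrt (∑ j : Fin d, lam j ^ 2)) *
                Real.sqrt (2 * Real.log δ⁻¹ / n)} := by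
  refine (le_measure_forall_mem_Flam hn hM hlam P hsupp hδ.1 (by linarith [hδ.2])).trans
    (measure_mono ?_)
  rintro x ⟨hxK, hx⟩ ν hν hν1
  have := isProbabilityMeasure_empMeasure hn x
  have hemp : empMeasure x (Metric.closedBall 0 M)ᶜ = 0 :=
    empMeasure_compl_eq_zero Metric.isClosed_closedBall.measurableSet hxK
  have htri := MPW_triangle hlam (integrable_norm_of_compl_closedBall hsupp)
    (integrable_norm_of_compl_closedBall hemp) ⟨measurable_norm.aestronglyMeasurable, hν1⟩
  have hdev := MPW_le_of_forall_mem_Flam hlam hsupp hemp fun φ hφ =>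
    (integral_empMeasure x (continuous_of_mem_Flam hφ).stronglyMeasurable).symm ▸ hx φ hφ
  linarith
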